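/- Let b be a rational function in the closed unit ball of H∞ with ‖b‖∞ = 1 that is not a finite Blaschke product. Let φ ∈ H(b) ∩ ball(H∞) with φ(ξ_j) ∈ Z_T(a) for 1 ≤ j ≤ p and φ(ξ_j) ∈ D for p+1 ≤ j ≤ n, and let u = (a₁ ∘ φ) · ∏_{j=p+1}^n (φ − φ(ξ_j))^{m_j} / a₁. If u belongs to the de Branges–Rovnyak space H(φ), then the composition operator C_φ is bounded on H(b). -/

import Mathlib

open Complex MeasureTheory Set Filter

noncomputable section

attribute [local instance] Classical.propDecidable

/-- The open unit disk in `ℂ`. -/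
def unitDisk : Set ℂ := Metric.ball 0 1

/-- The unit circle in `ℂ`. -/
def unitCircle : Set ℂ := Metric.sphere 0 1

/-- Membership in `H^∞`: analytic and bounded on the unit disk. -/
def MemHinf (f : ℂ → ℂ) : Prop :=
  DifferentiableOn ℂ f unitDisk ∧ ∃ C : ℝ, ∀ z ∈ unitDisk, ‖f z‖ ≤ C

/-- Membership in the closed unit ball of `H^∞`. -/
def MemBallHinf (f : ℂ → ℂ) : Prop :=
  DifferentiableOn ℂ f unitDisk ∧ ∀ z ∈ unitDisk, ‖f z‖ ≤ 1

/-- `f` agrees on the closed unit disk with a rational function without poles there. -/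
def IsRationalOnDisk (f : ℂ → ℂ) : Prop :=
  ∃ P Q : Polynomial ℂ, ∀ z ∈ Metric.closedBall (0:ℂ) 1,
    Q.eval z ≠ 0 ∧ f z = P.eval z / Q.eval z

/-- `f` is a finite Blaschke product (multiplicities are encoded by repetition). -/
def IsFiniteBlaschke (f : ℂ → ℂ) : Prop :=
  ∃ (γ : ℂ) (k : ℕ) (lam : Fin k → ℂ), ‖γ‖ = 1 ∧ (∀ i, lam i ∈ unitDisk) ∧
    ∀ z ∈ unitDisk, f z = γ * ∏ i, (z - lam i) / (1 - (starRingEnd ℂ) (lam i) * z)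

/-- The `k`-th Taylor coefficient of `f` at the origin. -/
def taylorCoeff (f : ℂ → ℂ) (k : ℕ) : ℂ := iteratedDeriv k f 0 / k.factorial

/-- Membership in the Hardy space `H²` (square-summable Taylor coefficients). -/
def MemH2 (f : ℂ → ℂ) : Prop :=
  DifferentiableOn ℂ f unitDisk ∧ Summable fun k => ‖taylorCoeff f k‖ ^ 2

/-- The squared `H²` norm. -/
def h2NormSq (f : ℂ → ℂ) : ℝ := ∑' k, ‖taylorCoeff f k‖ ^ 2

/-- The `H²` inner product. -/
def h2Inner (f g : ℂ → ℂ) : ℂ :=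
  ∑' k, (starRingEnd ℂ) (taylorCoeff f k) * taylorCoeff g k

/-- The polynomial `a₁(z) = ∏ⱼ (z − ξⱼ)^{mⱼ}`. -/
def a1fun {n : ℕ} (ξ : Fin n → ℂ) (m : Fin n → ℕ) : ℂ → ℂ :=
  fun z => ∏ j, (z - ξ j) ^ (m j)

/-- A decomposition `f = a₁ g + q` with `g ∈ H²`, `deg q ≤ N − 1`, witnessing membership
in `H(b) = a₁H² ⊕ P_{N−1}`. -/
def HbDecompOf {n : ℕ} (ξ : Fin n → ℂ) (m : Fin n → ℕ)
    (f g : ℂ → ℂ) (q : Polynomial ℂ) : Prop :=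
  MemH2 g ∧ q.degree < ((∑ j, m j : ℕ) : WithBot ℕ) ∧
    ∀ z ∈ unitDisk, f z = a1fun ξ m z * g z + q.eval z

/-- Membership in `H(b) = a₁ H² ⊕ P_{N−1}` (description of `H(b)` for `b` rational,
not a finite Blaschke product, whose pythagorean mate has boundary zeros `ξ` with
multiplicities `m`). -/
def MemHb {n : ℕ} (ξ : Fin n → ℂ) (m : Fin n → ℕ) (f : ℂ → ℂ) : Prop :=
  ∃ gq : (ℂ → ℂ) × Polynomial ℂ, HbDecompOf ξ m f gq.1 gq.2

/-- The (unique) decomposition of a member of `H(b)`. -/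
def hbDecomp {n : ℕ} (ξ : Fin n → ℂ) (m : Fin n → ℕ) (f : ℂ → ℂ) :
    (ℂ → ℂ) × Polynomial ℂ :=
  if h : MemHb ξ m f then h.choose else (0, 0)

/-- The squared norm `⦀a₁g + q⦀² = ‖g‖²_{H²} + ‖q‖²_{H²}` on `H(b)`. -/
def hbNormSq {n : ℕ} (ξ : Fin n → ℂ) (m : Fin n → ℕ) (f : ℂ → ℂ) : ℝ :=
  h2NormSq (hbDecomp ξ m f).1 + h2NormSq fun z => ((hbDecomp ξ m f).2).eval z

/-- The inner product on `H(b)` induced by the decomposition. -/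
def hbInner {n : ℕ} (ξ : Fin n → ℂ) (m : Fin n → ℕ) (f g : ℂ → ℂ) : ℂ :=
  h2Inner (hbDecomp ξ m f).1 (hbDecomp ξ m g).1 +
    h2Inner (fun z => ((hbDecomp ξ m f).2).eval z)
      (fun z => ((hbDecomp ξ m g).2).eval z)

/-- The Stolz angle (non-tangential approach region) at a boundary point `ξ`. -/
def stolzAngle (ξ : ℂ) (M : ℝ) : Set ℂ := {z ∈ unitDisk | ‖z - ξ‖ ≤ M * (1 - ‖z‖)}

/-- `f` has non-tangential limit `L` at `ξ`. -/
def NTLimit (f : ℂ → ℂ) (ξ L : ℂ) : Prop :=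
  ∀ M : ℝ, 1 < M → Tendsto f (nhdsWithin ξ (stolzAngle ξ M)) (nhds L)

/-- Radial boundary value of `f` at `ζ` (junk value if the radial limit does not exist). -/
def bdryVal (f : ℂ → ℂ) (ζ : ℂ) : ℂ :=
  limUnder (nhdsWithin (1:ℝ) (Set.Iio 1)) fun r : ℝ => f ((r : ℂ) * ζ)

/-- The full setting: `b` is a rational function in the closed unit ball of `H^∞` with
`‖b‖_∞ = 1` which is not a finite Blaschke product; `a` is its pythagorean mate (rational,
outer — i.e. zero-free on the disk —, `a(0) > 0`, `|a|² + |b|² = 1` on the circle); the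
`ξ j` are the distinct zeros of `a` on the unit circle, with multiplicities `m j`. -/
structure RationalSetting (b a : ℂ → ℂ) (n : ℕ) (ξ : Fin n → ℂ) (m : Fin n → ℕ) :
    Prop where
  b_diff : DifferentiableOn ℂ b unitDisk
  b_rat : IsRationalOnDisk b
  b_le_one : ∀ z ∈ unitDisk, ‖b z‖ ≤ 1
  b_norm_one : sSup ((fun z => ‖b z‖) '' unitDisk) = 1
  b_not_fbp : ¬ IsFiniteBlaschke b
  a_diff : DifferentiableOn ℂ a unitDisk
  a_rat : IsRationalOnDisk a
  a_outer : ∀ z ∈ unitDisk, a z ≠ 0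
  a_zero_pos : 0 < (a 0).re ∧ (a 0).im = 0
  pyth : ∀ ζ ∈ unitCircle, ‖a ζ‖ ^ 2 + ‖b ζ‖ ^ 2 = 1
  zeros_mem : ∀ j, ξ j ∈ unitCircle
  zeros_inj : Function.Injective ξ
  mult_pos : ∀ j, 0 < m j
  factor : ∃ g : ℂ → ℂ, IsRationalOnDisk g ∧ (∀ ζ ∈ unitCircle, g ζ ≠ 0) ∧
    ∀ z ∈ Metric.closedBall (0:ℂ) 1, a z = a1fun ξ m z * g z

/-- The composition operator `C_φ` maps `H(b)` into itself and is bounded there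
(with respect to the equivalent norm `⦀·⦀_b`). -/
def CompBddHb {n : ℕ} (ξ : Fin n → ℂ) (m : Fin n → ℕ) (φ : ℂ → ℂ) : Prop :=
  (∀ f, MemHb ξ m f → MemHb ξ m fun z => f (φ z)) ∧
  ∃ C : ℝ, ∀ f, MemHb ξ m f →
    hbNormSq ξ m (fun z => f (φ z)) ≤ C * hbNormSq ξ m f

/-- The composition operator `C_φ` is compact on `H(b)`: it is bounded and the image of
every sequence in the unit ball has a subsequence whose image converges in `H(b)`. -/
def CompCompactHb {n : ℕ} (ξ : Fin n → ℂ) (m : Fin n → ℕ) (φ : ℂ → ℂ) : Prop :=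
  CompBddHb ξ m φ ∧
  ∀ f : ℕ → ℂ → ℂ, (∀ k, MemHb ξ m (f k) ∧ hbNormSq ξ m (f k) ≤ 1) →
    ∃ (κ : ℕ → ℕ) (g : ℂ → ℂ), StrictMono κ ∧ MemHb ξ m g ∧
      Tendsto (fun i => hbNormSq ξ m fun z => f (κ i) (φ z) - g z) atTop (nhds 0)

/-- The composition operator `C_φ` is Hilbert–Schmidt on `H(b)`: it is bounded and the sum
of `⦀C_φ e⦀²` over the orthonormal basis `{a₁ z^k}ₖ ∪ {z^j}_{j<N}` of
`(H(b), ⦀·⦀_b)` is finite (the finite part of the sum being automatically finite). -/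
def CompHSHb {n : ℕ} (ξ : Fin n → ℂ) (m : Fin n → ℕ) (φ : ℂ → ℂ) : Prop :=
  CompBddHb ξ m φ ∧
  Summable fun k : ℕ => hbNormSq ξ m fun z => a1fun ξ m (φ z) * φ z ^ k

/-- The weighted composition operator `W_{u,φ} f = u · (f ∘ φ)` maps `H²` boundedly
into itself. -/
def WCompBddH2 (u φ : ℂ → ℂ) : Prop :=
  (∀ f, MemH2 f → MemH2 fun z => u z * f (φ z)) ∧
  ∃ C : ℝ, ∀ f, MemH2 f →
    h2NormSq (fun z => u z * f (φ z)) ≤ C * h2NormSq f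

/-- The weighted composition operator `W_{u,φ}` is compact on `H²`. -/
def WCompCompactH2 (u φ : ℂ → ℂ) : Prop :=
  WCompBddH2 u φ ∧
  ∀ f : ℕ → ℂ → ℂ, (∀ k, MemH2 (f k) ∧ h2NormSq (f k) ≤ 1) →
    ∃ (κ : ℕ → ℕ) (g : ℂ → ℂ), StrictMono κ ∧ MemH2 g ∧
      Tendsto (fun i => h2NormSq fun z => u z * f (κ i) (φ z) - g z) atTop (nhds 0)

/-- The weighted composition operator `W_{u,φ}` is Hilbert–Schmidt on `H²`
(sum over the orthonormal basis `{z^k}` of `H²`). -/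
def WCompHSH2 (u φ : ℂ → ℂ) : Prop :=
  WCompBddH2 u φ ∧ Summable fun k : ℕ => h2NormSq fun z => u z * φ z ^ k

/-- The function `u = (a₁ ∘ φ) · ∏_{j ≥ p} (φ − φ(ξⱼ))^{mⱼ} / a₁`, where `Λ j = φ(ξ j)`
are the non-tangential limits of `φ` at the zeros of the mate. -/
def ufun {n : ℕ} (p : ℕ) (ξ : Fin n → ℂ) (m : Fin n → ℕ) (Λ : Fin n → ℂ)
    (φ : ℂ → ℂ) : ℂ → ℂ :=
  fun z => a1fun ξ m (φ z) *
    (∏ j ∈ Finset.univ.filter fun j : Fin n => p ≤ (j : ℕ), (φ z - Λ j) ^ (m j)) /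
      a1fun ξ m z

/-- The reproducing kernel of the de Branges–Rovnyak space `H(c)`:
`k_λ^c(z) = (1 − conj(c(λ)) c(z)) / (1 − conj(λ) z)`, as a function of the parameter `λ`
and the evaluation point `z`. -/
def rkKernel (c : ℂ → ℂ) (lam z : ℂ) : ℂ :=
  (1 - (starRingEnd ℂ) (c lam) * c z) / (1 - (starRingEnd ℂ) lam * z)

/-- `f` belongs to the reproducing kernel Hilbert space `H(c)` with squared norm at
most `t`: for all finite linear combinations of kernels,
`|⟨f, Σ αᵢ k_{λᵢ}⟩|² ≤ t · ‖Σ αᵢ k_{λᵢ}‖²`. -/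
def HbRKBound (c f : ℂ → ℂ) (t : ℝ) : Prop :=
  ∀ (k : ℕ) (lam α : Fin k → ℂ), (∀ i, lam i ∈ unitDisk) →
    ‖∑ i, (starRingEnd ℂ) (α i) * f (lam i)‖ ^ 2 ≤
      t * (∑ i, ∑ j, α i * (starRingEnd ℂ) (α j) * rkKernel c (lam i) (lam j)).re

/-- Membership in the de Branges–Rovnyak space `H(c)` (general RKHS definition). -/
def MemHbRK (c f : ℂ → ℂ) : Prop := ∃ t : ℝ, HbRKBound c f t

/-- `φ` has an angular derivative in the sense of Carathéodory at `ξ`: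
`φ` and `φ'` have non-tangential limits at `ξ` and `|φ(ξ)| = 1`. -/
def HasADC (φ : ℂ → ℂ) (ξ : ℂ) : Prop :=
  ∃ L L' : ℂ, ‖L‖ = 1 ∧ NTLimit φ ξ L ∧ NTLimit (deriv φ) ξ L'

/-- The measure `μ_{u,φ}(E) = ∫_{φ⁻¹(E) ∩ T} |u|² dm` (boundary values on the circle,
normalized Lebesgue measure). -/
def muMeas (u φ : ℂ → ℂ) (E : Set ℂ) : ENNReal :=
  (ENNReal.ofReal (2 * Real.pi))⁻¹ *
    ∫⁻ θ in Set.Ioc (0:ℝ) (2 * Real.pi),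
      (if bdryVal φ (Complex.exp (θ * Complex.I)) ∈ E then
        ENNReal.ofReal (‖bdryVal u (Complex.exp (θ * Complex.I))‖ ^ 2) else 0)

/-- `μ_{u,φ}` is a Carleson measure: `μ(S(ζ,r)) ≤ M r` for all Carleson windows
`S(ζ,r) = {z : |z| ≤ 1, |z − ζ| ≤ r}`, `ζ ∈ T`, `0 < r < 1`. -/
def IsCarleson (u φ : ℂ → ℂ) : Prop :=
  ∃ M : ℝ, 0 < M ∧ ∀ ζ ∈ unitCircle, ∀ r ∈ Set.Ioo (0:ℝ) 1,
    muMeas u φ (Metric.closedBall ζ r ∩ Metric.closedBall 0 1) ≤ ENNReal.ofReal (M * r)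

/-- `μ_{u,φ}` is a vanishing Carleson measure: `sup_{ζ∈T} μ(S(ζ,r))/r → 0` as `r → 0`. -/
def IsVanishingCarleson (u φ : ℂ → ℂ) : Prop :=
  ∀ ε > (0:ℝ), ∃ r₀ ∈ Set.Ioo (0:ℝ) 1, ∀ r ∈ Set.Ioo (0:ℝ) r₀, ∀ ζ ∈ unitCircle,
    muMeas u φ (Metric.closedBall ζ r ∩ Metric.closedBall 0 1) ≤ ENNReal.ofReal (ε * r)

/-- The reproducing kernel integral
`∫_T (1 − |w|²) |u(ξ)|² / |1 − conj(w) φ(ξ)|² dm(ξ)`. -/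
def repKerInt (u φ : ℂ → ℂ) (w : ℂ) : ENNReal :=
  (ENNReal.ofReal (2 * Real.pi))⁻¹ *
    ∫⁻ θ in Set.Ioc (0:ℝ) (2 * Real.pi),
      ENNReal.ofReal ((1 - ‖w‖ ^ 2) * ‖bdryVal u (Complex.exp (θ * Complex.I))‖ ^ 2 /
        ‖1 - (starRingEnd ℂ) w * bdryVal φ (Complex.exp (θ * Complex.I))‖ ^ 2)

/-- The sequence space `ℓ²`, a model of `H²`. -/
abbrev HH := lp (fun _ : ℕ => ℂ) 2

theorem HH_summable (x : HH) : HasSum (fun k => ‖x k‖ ^ 2) (‖x‖ ^ 2) := by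
  have h := lp.hasSum_norm (p := 2) (by norm_num) x
  simpa using h

/-- Build an element of `ℓ²`. -/
def mkH (f : ℕ → ℂ) (h : Summable fun k => ‖f k‖ ^ 2) : HH :=
  ⟨f, memℓp_gen (by simpa using h)⟩

theorem mkH_apply (f : ℕ → ℂ) (h : Summable fun k => ‖f k‖ ^ 2) (k : ℕ) :
    mkH f h k = f k := rfl

theorem mem_disk {z : ℂ} : z ∈ unitDisk ↔ ‖z‖ < 1 := by
  simp [unitDisk]

theorem kv_summable {z : ℂ} (hz : ‖z‖ < 1) :
    Summable fun k : ℕ => ‖(starRingEnd ℂ z) ^ k‖ ^ 2 := by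
  have : ∀ k : ℕ, ‖(starRingEnd ℂ z) ^ k‖ ^ 2 = (‖z‖ ^ 2) ^ k := by
    intro k
    rw [norm_pow, RCLike.norm_conj, ← pow_mul, ← pow_mul, mul_comm]
  simp only [this]
  exact summable_geometric_of_lt_one (by positivity) (by nlinarith [norm_nonneg z])

/-- The Szegő kernel vector at `z`. -/
def kv (z : ℂ) : HH :=
  if hz : ‖z‖ < 1 then mkH (fun k => (starRingEnd ℂ z) ^ k) (kv_summable hz) else 0

theorem kv_apply {z : ℂ} (hz : ‖z‖ < 1) (k : ℕ) : kv z k = (starRingEnd ℂ z) ^ k := by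
  simp only [kv, hz, dif_pos]
  rfl

/-- Evaluation of the function with Taylor coefficients `x` at the point `z`. -/
def ev (z : ℂ) (x : HH) : ℂ := inner ℂ (kv z) x

theorem ev_hasSum {z : ℂ} (hz : ‖z‖ < 1) (x : HH) : HasSum (fun k => x k * z ^ k) (ev z x) := by
  have h := lp.hasSum_inner (𝕜 := ℂ) (kv z) x
  have e : (fun k => inner ℂ (kv z k) (x k)) = fun k => x k * z ^ k := by
    funext k
    simp [kv_apply hz]
  rw [e] at h
  exact h

theorem ev_add (z : ℂ) (x y : HH) : ev z (x + y) = ev z x + ev z y := inner_add_right _ _ _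

theorem ev_sub (z : ℂ) (x y : HH) : ev z (x - y) = ev z x - ev z y := inner_sub_right _ _ _

theorem ev_smul (z c : ℂ) (x : HH) : ev z (c • x) = c * ev z x := inner_smul_right _ _ _

theorem disk_eq_eball : unitDisk = Metric.eball (0 : ℂ) 1 := by
  rw [unitDisk, ← Metric.eball_ofReal, ENNReal.ofReal_one]

theorem ev_powerSeries (x : HH) :
    HasFPowerSeriesOnBall (fun z => ev z x) (FormalMultilinearSeries.ofScalars ℂ (fun k => x k))
      0 1 where
  r_le := by
    have := FormalMultilinearSeries.le_radius_of_bound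
      (FormalMultilinearSeries.ofScalars ℂ (fun k => x k)) (r := 1) ‖x‖ (by
        intro n
        rw [FormalMultilinearSeries.ofScalars_norm]
        simpa using lp.norm_apply_le_norm (by norm_num) x n)
    simpa using this
  r_pos := by norm_num
  hasSum := by
    intro y hy
    rw [← disk_eq_eball, mem_disk] at hy
    have := ev_hasSum hy x
    simpa [FormalMultilinearSeries.ofScalars_apply_eq, mul_comm] using this

theorem taylorCoeff_of_eq {f : ℂ → ℂ} {x : HH} (h : ∀ z ∈ unitDisk, f z = ev z x) (k : ℕ) :
    taylorCoeff f k = x k := by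
  have h1 : HasFPowerSeriesOnBall f (FormalMultilinearSeries.ofScalars ℂ (fun k => x k)) 0 1 :=
    (ev_powerSeries x).congr (by
      intro z hz
      rw [← disk_eq_eball] at hz
      exact (h z hz).symm)
  have h2 := h1.analyticAt.hasFPowerSeriesAt.eq_formalMultilinearSeries h1.hasFPowerSeriesAt
  have h3 := FormalMultilinearSeries.ofScalars_series_injective (E := ℂ) (𝕜 := ℂ) h2
  exact congrFun h3 k

theorem memH2_of_eq {f : ℂ → ℂ} {x : HH} (h : ∀ z ∈ unitDisk, f z = ev z x) : MemH2 f := by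
  constructor
  · have := (ev_powerSeries x).differentiableOn
    rw [← disk_eq_eball] at this
    exact this.congr h
  · simp only [taylorCoeff_of_eq h]
    exact (HH_summable x).summable

theorem h2NormSq_of_eq {f : ℂ → ℂ} {x : HH} (h : ∀ z ∈ unitDisk, f z = ev z x) :
    h2NormSq f = ‖x‖ ^ 2 := by
  simp only [h2NormSq, taylorCoeff_of_eq h]
  exact (HH_summable x).tsum_eq

theorem exists_of_memH2 {f : ℂ → ℂ} (h : MemH2 f) : ∃ x : HH, ∀ z ∈ unitDisk, f z = ev z x := by
  refine ⟨mkH _ h.2, fun z hz => ?_⟩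
  have h1 := Complex.hasSum_taylorSeries_on_ball h.1 hz
  have h2 := ev_hasSum (mem_disk.1 hz) (mkH _ h.2)
  have e : (fun k : ℕ => (k.factorial : ℂ)⁻¹ • (z - 0) ^ k • iteratedDeriv k f 0)
      = fun k => mkH _ h.2 k * z ^ k := by
    funext k
    rw [mkH_apply, taylorCoeff]
    simp only [sub_zero, smul_eq_mul]
    ring
  rw [e] at h1
  exact h1.unique h2

theorem ev_inj {x y : HH} (h : ∀ z ∈ unitDisk, ev z x = ev z y) : x = y := by
  ext k
  rw [← taylorCoeff_of_eq (f := fun z => ev z x) (fun _ _ => rfl) k, taylorCoeff_of_eq h k]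

/-- `f` agrees on the disk with an `H²` function. -/
def InH2 (f : ℂ → ℂ) : Prop := ∃ x : HH, ∀ z ∈ unitDisk, f z = ev z x

theorem InH2.add {f g : ℂ → ℂ} (hf : InH2 f) (hg : InH2 g) : InH2 (fun z => f z + g z) := by
  obtain ⟨x, hx⟩ := hf
  obtain ⟨y, hy⟩ := hg
  exact ⟨x + y, fun z hz => by simp only [ev_add, hx z hz, hy z hz]⟩

theorem InH2.smul {f : ℂ → ℂ} (c : ℂ) (hf : InH2 f) : InH2 (fun z => c * f z) := by
  obtain ⟨x, hx⟩ := hf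
  exact ⟨c • x, fun z hz => by simp only [ev_smul, hx z hz]⟩

theorem InH2.congr {f g : ℂ → ℂ} (hf : InH2 f) (h : ∀ z ∈ unitDisk, g z = f z) : InH2 g := by
  obtain ⟨x, hx⟩ := hf
  exact ⟨x, fun z hz => by rw [h z hz, hx z hz]⟩

theorem bshift_summable (x : HH) : Summable fun k => ‖x (k + 1)‖ ^ 2 :=
  (summable_nat_add_iff 1).2 (HH_summable x).summable

/-- Backward shift. -/
def bshift : HH →L[ℂ] HH :=
  LinearMap.mkContinuous
    { toFun := fun x => mkH (fun k => x (k + 1)) (bshift_summable x)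
      map_add' := fun x y => by ext k; rfl
      map_smul' := fun c x => by ext k; rfl } 1 (by
    intro x
    rw [one_mul]
    refine abs_le_of_sq_le_sq' ?_ (norm_nonneg _) |>.2
    have h1 := HH_summable (mkH (fun k => x (k + 1)) (bshift_summable x))
    have h2 := HH_summable x
    have h3 := h2.summable.sum_add_tsum_nat_add 1
    rw [h2.tsum_eq] at h3
    change ‖mkH (fun k => x (k + 1)) (bshift_summable x)‖ ^ 2 ≤ _
    rw [← h3, ← h1.tsum_eq]
    simp only [mkH_apply]
    have : 0 ≤ ∑ i ∈ Finset.range 1, ‖x i‖ ^ 2 := Finset.sum_nonneg fun _ _ => by positivity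
    linarith)

theorem bshift_apply (x : HH) (k : ℕ) : bshift x k = x (k + 1) := rfl

theorem bshift_norm : ‖bshift‖ ≤ 1 := LinearMap.mkContinuous_norm_le _ zero_le_one _

theorem ev_bshift {z : ℂ} (hz : ‖z‖ < 1) (x : HH) : z * ev z (bshift x) = ev z x - x 0 := by
  have h1 := (ev_hasSum hz (bshift x)).mul_left z
  have h2 := (hasSum_nat_add_iff' 1).2 (ev_hasSum hz x)
  simp only [Finset.range_one, Finset.sum_singleton, pow_zero, mul_one] at h2
  have e : (fun k : ℕ => z * (bshift x k * z ^ k)) = fun k => x (k + 1) * z ^ (k + 1) := by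
    funext k
    rw [bshift_apply]; ring
  rw [e] at h1
  exact h1.unique h2

/-- Forward shift of a sequence. -/
def fseq (x : ℕ → ℂ) : ℕ → ℂ
  | 0 => 0
  | k + 1 => x k

theorem fshift_summable (x : HH) : Summable fun k => ‖fseq (fun j => x j) k‖ ^ 2 :=
  (summable_nat_add_iff 1).1 (HH_summable x).summable

/-- Forward shift. -/
def fshift (x : HH) : HH := mkH (fseq fun j => x j) (fshift_summable x)

theorem fshift_succ (x : HH) (k : ℕ) : fshift x (k + 1) = x k := rfl

theorem fshift_zero (x : HH) : fshift x 0 = 0 := rfl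

theorem ev_fshift {z : ℂ} (hz : ‖z‖ < 1) (x : HH) : ev z (fshift x) = z * ev z x := by
  have h := ev_bshift hz (fshift x)
  have : bshift (fshift x) = x := by ext k; rfl
  rw [this, fshift_zero] at h
  rw [h, sub_zero]

theorem InH2.mul_z {f : ℂ → ℂ} (hf : InH2 f) : InH2 (fun z => z * f z) := by
  obtain ⟨x, hx⟩ := hf
  exact ⟨fshift x, fun z hz => by simp only [ev_fshift (mem_disk.1 hz), hx z hz]⟩

open Polynomial in
theorem InH2.mul_poly {f : ℂ → ℂ} (hf : InH2 f) (q : ℂ[X]) :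
    InH2 (fun z => q.eval z * f z) := by
  induction q using Polynomial.induction_on with
  | C a => simpa using hf.smul a
  | add p q hp hq =>
    refine (hp.add hq).congr fun z _ => ?_
    simp only [eval_add]; ring
  | monomial n a h =>
    refine h.mul_z.congr fun z _ => ?_
    simp [pow_succ]; ring

/-- The Taylor coefficients of a polynomial as an element of `ℓ²`. -/
def polyH (q : Polynomial ℂ) : HH :=
  mkH (fun k => q.coeff k) (summable_of_ne_finset_zero (s := q.support) (fun k hk => by
    simp [Polynomial.notMem_support_iff.1 hk]))

theorem ev_polyH {z : ℂ} (hz : ‖z‖ < 1) (q : Polynomial ℂ) : ev z (polyH q) = q.eval z := by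
  have h1 := ev_hasSum hz (polyH q)
  refine h1.unique ?_
  rw [Polynomial.eval_eq_sum, Polynomial.sum]
  refine hasSum_sum_of_ne_finset_zero fun k hk => ?_
  change q.coeff k * _ = 0
  simp [Polynomial.notMem_support_iff.1 hk]

theorem InH2.poly (q : Polynomial ℂ) : InH2 (fun z => q.eval z) :=
  ⟨polyH q, fun _ hz => (ev_polyH (mem_disk.1 hz) q).symm⟩

theorem inH2_of_bound (F : ℂ → ℂ) (K : ℝ)
    (h : ∀ (k : ℕ) (lam α : Fin k → ℂ), (∀ i, lam i ∈ unitDisk) →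
      ‖∑ i, (starRingEnd ℂ) (α i) * F (lam i)‖ ≤ K * ‖∑ i, α i • kv (lam i)‖) : InH2 F := by
  let Φ : (unitDisk →₀ ℂ) →ₗ[ℂ] HH := Finsupp.linearCombination ℂ (fun z : unitDisk => kv z)
  let L : (unitDisk →₀ ℂ) →ₗ[ℂ] ℂ :=
    Finsupp.linearCombination ℂ (fun z : unitDisk => (starRingEnd ℂ) (F z))
  have hb : ∀ α, ‖L α‖ ≤ K * ‖Φ α‖ := by
    intro α
    let e := α.support.equivFin
    have h1 := h α.support.card (fun i => ((e.symm i : unitDisk) : ℂ))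
      (fun i => α (e.symm i)) (fun i => (e.symm i : unitDisk).2)
    have e1 : Φ α = ∑ i, α (e.symm i) • kv ((e.symm i : unitDisk) : ℂ) := by
      rw [e.symm.sum_comp (fun z : α.support => α z • kv ((z : unitDisk) : ℂ))]
      rw [Finset.sum_coe_sort α.support (fun z : unitDisk => α z • kv (z : ℂ))]
      rfl
    have e2 : L α = (starRingEnd ℂ)
        (∑ i, (starRingEnd ℂ) (α (e.symm i)) * F ((e.symm i : unitDisk) : ℂ)) := by
      rw [e.symm.sum_comp (fun z : α.support => (starRingEnd ℂ) (α z) * F ((z : unitDisk) : ℂ))]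
      rw [Finset.sum_coe_sort α.support (fun z : unitDisk => (starRingEnd ℂ) (α z) * F (z : ℂ))]
      rw [map_sum]
      simp only [map_mul, Complex.conj_conj]
      rfl
    rw [e1, e2, RCLike.norm_conj]
    exact h1
  have hker : LinearMap.ker Φ ≤ LinearMap.ker L := by
    intro α hα
    rw [LinearMap.mem_ker] at hα ⊢
    have := hb α
    rw [hα, norm_zero, mul_zero] at this
    exact norm_le_zero_iff.1 this
  let ℓ₀ : LinearMap.range Φ →ₗ[ℂ] ℂ :=
    ((LinearMap.ker Φ).liftQ L hker).comp Φ.quotKerEquivRange.symm.toLinearMap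
  have hℓ₀ : ∀ α, ℓ₀ ⟨Φ α, LinearMap.mem_range_self Φ α⟩ = L α := by
    intro α
    simp only [ℓ₀, LinearMap.comp_apply, LinearEquiv.coe_coe]
    rw [LinearMap.quotKerEquivRange_symm_apply_image]
    rfl
  let ℓ₁ : StrongDual ℂ (LinearMap.range Φ) := ℓ₀.mkContinuous K (by
    rintro ⟨y, α, rfl⟩
    rw [hℓ₀]
    exact hb α)
  obtain ⟨g, hg, -⟩ := exists_extension_norm_eq (LinearMap.range Φ) ℓ₁
  refine ⟨(InnerProductSpace.toDual ℂ HH).symm g, fun z hz => ?_⟩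
  have h1 : g (kv z) = (starRingEnd ℂ) (F z) := by
    have e1 : Φ (Finsupp.single ⟨z, hz⟩ 1) = kv z := by simp [Φ]
    have e2 : L (Finsupp.single ⟨z, hz⟩ 1) = (starRingEnd ℂ) (F z) := by simp [L]
    have := hg ⟨Φ (Finsupp.single ⟨z, hz⟩ 1), LinearMap.mem_range_self Φ _⟩
    rw [← e2, ← hℓ₀]
    rw [← e1]
    exact this
  rw [ev, ← inner_conj_symm, InnerProductSpace.toDual_symm_apply, h1, Complex.conj_conj]

/-- If `F` is a pairing against vectors dominated by the kernels, then `F` is in `H²`. -/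
theorem inH2_of_vec (w : ℂ → HH) (x : HH) (F : ℂ → ℂ) (t : ℝ) (ht : 0 ≤ t)
    (hF : ∀ z ∈ unitDisk, F z = inner ℂ (w z) x)
    (h : ∀ (k : ℕ) (lam α : Fin k → ℂ), (∀ i, lam i ∈ unitDisk) →
      ‖∑ i, α i • w (lam i)‖ ^ 2 ≤ t * ‖∑ i, α i • kv (lam i)‖ ^ 2) : InH2 F := by
  refine inH2_of_bound F (Real.sqrt t * ‖x‖) fun k lam α hl => ?_
  have e : ∑ i, (starRingEnd ℂ) (α i) * F (lam i) = inner ℂ (∑ i, α i • w (lam i)) x := by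
    rw [sum_inner]
    refine Finset.sum_congr rfl fun i _ => ?_
    rw [inner_smul_left, hF _ (hl i)]
  rw [e]
  refine (norm_inner_le_norm _ _).trans ?_
  have h1 : ‖∑ i, α i • w (lam i)‖ ≤ Real.sqrt t * ‖∑ i, α i • kv (lam i)‖ := by
    refine (abs_le_of_sq_le_sq' ?_ (by positivity)).2
    rw [mul_pow, Real.sq_sqrt ht]
    exact h k lam α hl
  nlinarith [mul_le_mul_of_nonneg_right h1 (norm_nonneg x)]

theorem kv_norm_sq (k : ℕ) (lam α : Fin k → ℂ) (hl : ∀ i, lam i ∈ unitDisk) :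
    ((‖∑ i, α i • kv (lam i)‖ ^ 2 : ℝ) : ℂ) =
      ∑ i, ∑ j, α i * (starRingEnd ℂ) (α j) * (1 - (starRingEnd ℂ) (lam i) * lam j)⁻¹ := by
  have h0 := inner_self_eq_norm_sq_to_K (𝕜 := ℂ) (∑ i, α i • kv (lam i))
  push_cast
  rw [← show ((‖∑ i, α i • kv (lam i)‖ : ℂ)) ^ 2 = _ from rfl] 
  refine h0.symm.trans ?_
  rw [inner_sum]
  refine Finset.sum_congr rfl fun i _ => ?_
  rw [sum_inner]
  refine Finset.sum_congr rfl fun j _ => ?_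
  rw [inner_smul_left, inner_smul_right]
  have hk : inner ℂ (kv (lam j)) (kv (lam i)) = (1 - (starRingEnd ℂ) (lam i) * lam j)⁻¹ := by
    have h1 := ev_hasSum (mem_disk.1 (hl j)) (kv (lam i))
    have e : (fun n => kv (lam i) n * lam j ^ n) =
        fun n => ((starRingEnd ℂ) (lam i) * lam j) ^ n := by
      funext n
      rw [kv_apply (mem_disk.1 (hl i)), mul_pow]
    rw [e] at h1
    refine h1.unique (hasSum_geometric_of_norm_lt_one ?_)
    rw [norm_mul, RCLike.norm_conj]
    have a1 := mem_disk.1 (hl i)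
    have a2 := mem_disk.1 (hl j)
    nlinarith [norm_nonneg (lam i), norm_nonneg (lam j)]
  rw [hk]
  ring

theorem rk_sum (φ : ℂ → ℂ) (k : ℕ) (lam α : Fin k → ℂ) (hl : ∀ i, lam i ∈ unitDisk) :
    (∑ i, ∑ j, α i * (starRingEnd ℂ) (α j) * rkKernel φ (lam i) (lam j)).re =
      ‖∑ i, α i • kv (lam i)‖ ^ 2 -
        ‖∑ i, (α i * (starRingEnd ℂ) (φ (lam i))) • kv (lam i)‖ ^ 2 := by
  have h1 := kv_norm_sq k lam α hl
  have h2 := kv_norm_sq k lam (fun i => α i * (starRingEnd ℂ) (φ (lam i))) hl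
  have : (∑ i, ∑ j, α i * (starRingEnd ℂ) (α j) * rkKernel φ (lam i) (lam j)) =
      ((‖∑ i, α i • kv (lam i)‖ ^ 2 -
        ‖∑ i, (α i * (starRingEnd ℂ) (φ (lam i))) • kv (lam i)‖ ^ 2 : ℝ) : ℂ) := by
    rw [Complex.ofReal_sub, h1, h2, ← Finset.sum_sub_distrib]
    refine Finset.sum_congr rfl fun i _ => ?_
    rw [← Finset.sum_sub_distrib]
    refine Finset.sum_congr rfl fun j _ => ?_
    simp only [rkKernel, map_mul, Complex.conj_conj]
    ring
  rw [this, Complex.ofReal_re]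

/-- The key telescoping estimate. -/
theorem jury_bound {φ u : ℂ → ℂ} {t : ℝ} (ht : 0 ≤ t) (hu : HbRKBound φ u t)
    (hφ : ∀ z ∈ unitDisk, φ z ∈ unitDisk)
    (k : ℕ) (lam α : Fin k → ℂ) (hl : ∀ i, lam i ∈ unitDisk) :
    ‖∑ i, α i • ((starRingEnd ℂ) (u (lam i)) • kv (φ (lam i)))‖ ^ 2 ≤
      t * ‖∑ i, α i • kv (lam i)‖ ^ 2 := by
  set v : HH := ∑ i, α i • ((starRingEnd ℂ) (u (lam i)) • kv (φ (lam i))) with hv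
  let S : ℕ → ℝ := fun n =>
    ‖∑ i, (α i * (starRingEnd ℂ) (φ (lam i)) ^ n) • kv (lam i)‖ ^ 2
  have hvn : ∀ n, ‖v n‖ ^ 2 ≤ t * (S n - S (n + 1)) := by
    intro n
    have h1 := hu k lam (fun i => α i * (starRingEnd ℂ) (φ (lam i)) ^ n) hl
    rw [rk_sum φ k lam _ hl] at h1
    have e1 : v n = (starRingEnd ℂ)
        (∑ i, (starRingEnd ℂ) (α i * (starRingEnd ℂ) (φ (lam i)) ^ n) * u (lam i)) := by
      rw [hv, lp.coeFn_sum, Finset.sum_apply, map_sum]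
      refine Finset.sum_congr rfl fun i _ => ?_
      simp only [lp.coeFn_smul, Pi.smul_apply, smul_eq_mul, map_mul, map_pow, Complex.conj_conj]
      rw [kv_apply (mem_disk.1 (hφ _ (hl i)))]
      ring
    rw [e1, RCLike.norm_conj]
    refine h1.trans (le_of_eq ?_)
    simp only [S, pow_succ, mul_assoc]
  have hsum : ∀ M, ∑ n ∈ Finset.range M, ‖v n‖ ^ 2 ≤ t * S 0 := by
    intro M
    calc ∑ n ∈ Finset.range M, ‖v n‖ ^ 2 ≤ ∑ n ∈ Finset.range M, t * (S n - S (n + 1)) :=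
          Finset.sum_le_sum fun n _ => hvn n
      _ = t * (S 0 - S M) := by rw [← Finset.mul_sum, Finset.sum_range_sub']
      _ ≤ t * S 0 := by
          apply mul_le_mul_of_nonneg_left _ ht
          have : 0 ≤ S M := by positivity
          linarith
  have h2 := le_of_tendsto' (HH_summable v).tendsto_sum_nat hsum
  simpa [S] using h2

theorem wcomp_inH2 {φ u : ℂ → ℂ} {t : ℝ} (ht : 0 ≤ t) (hu : HbRKBound φ u t)
    (hφ : ∀ z ∈ unitDisk, φ z ∈ unitDisk) {G : ℂ → ℂ} (hG : InH2 G) :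
    InH2 (fun z => u z * G (φ z)) := by
  obtain ⟨x, hx⟩ := hG
  refine inH2_of_vec (fun z => (starRingEnd ℂ) (u z) • kv (φ z)) x _ t ht (fun z hz => ?_)
    (fun k lam α hl => jury_bound ht hu hφ k lam α hl)
  rw [inner_smul_left, Complex.conj_conj, hx _ (hφ z hz)]
  rfl

theorem mult_inH2 {φ u : ℂ → ℂ} {t : ℝ} (ht : 0 < t) (hu : HbRKBound φ u t)
    {G : ℂ → ℂ} (hG : InH2 G) : InH2 (fun z => φ z * G z) := by
  obtain ⟨x, hx⟩ := hG
  refine inH2_of_vec (fun z => (starRingEnd ℂ) (φ z) • kv z) x _ 1 zero_le_one (fun z hz => ?_)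
    (fun k lam α hl => ?_)
  · rw [inner_smul_left, Complex.conj_conj]
    simp only [hx z hz]
    rfl
  · have h1 := hu k lam α hl
    rw [rk_sum φ k lam α hl] at h1
    have h2 := nonneg_of_mul_nonneg_right (le_trans (sq_nonneg _) h1) ht
    simp only [smul_smul]
    linarith

/-- Polynomials `A` such that `F ∈ H²`, `A F` a polynomial force `F` to be a polynomial. -/
def GoodA (A : Polynomial ℂ) : Prop :=
  ∀ F : ℂ → ℂ, InH2 F → ∀ q : Polynomial ℂ, (∀ z ∈ unitDisk, A.eval z * F z = q.eval z) →
    ∃ p : Polynomial ℂ, ∀ z ∈ unitDisk, F z = p.eval z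

theorem GoodA.one : GoodA 1 := fun F _ q h => ⟨q, fun z hz => by simpa using h z hz⟩

theorem GoodA.mul {A B : Polynomial ℂ} (hA : GoodA A) (hB : GoodA B) : GoodA (A * B) := by
  intro F hF q h
  obtain ⟨p, hp⟩ := hA (fun z => B.eval z * F z) (hF.mul_poly B) q (fun z hz => by
    rw [← h z hz, Polynomial.eval_mul]; ring)
  exact hB F hF p hp

theorem GoodA.pow {A : Polynomial ℂ} (hA : GoodA A) (k : ℕ) : GoodA (A ^ k) := by
  induction k with
  | zero => simpa using GoodA.one
  | succ k ih => rw [pow_succ]; exact ih.mul hA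

theorem GoodA.linear {ζ : ℂ} (hζ : ‖ζ‖ = 1) : GoodA (Polynomial.X - Polynomial.C ζ) := by
  rintro F ⟨x, hx⟩ q h
  have h1 : fshift x - ζ • x = polyH q := by
    refine ev_inj fun z hz => ?_
    have hz' := mem_disk.1 hz
    rw [ev_sub, ev_smul, ev_fshift hz', ev_polyH hz', ← h z hz, hx z hz]
    simp
    ring
  have h2 : ∀ k, x k - ζ * x (k + 1) = q.coeff (k + 1) := by
    intro k
    have := congrArg (fun y : HH => y (k + 1)) h1
    exact this
  have h3 : ∀ k, q.natDegree ≤ k → ‖x (k + 1)‖ = ‖x k‖ := by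
    intro k hk
    have := h2 k
    rw [Polynomial.coeff_eq_zero_of_natDegree_lt (by omega), sub_eq_zero] at this
    rw [this, norm_mul, hζ, one_mul]
  have h4 : ∀ j, ‖x (q.natDegree + j)‖ = ‖x q.natDegree‖ := by
    intro j
    induction j with
    | zero => rfl
    | succ j ih => rw [← ih, ← h3 (q.natDegree + j) (by omega)]; rfl
  have h5 : ‖x q.natDegree‖ ^ 2 = 0 := by
    have := (HH_summable x).summable.tendsto_atTop_zero
    have := this.comp (tendsto_add_atTop_nat q.natDegree)
    refine tendsto_nhds_unique ?_ this
    have e : ((fun k => ‖x k‖ ^ 2) ∘ fun a => a + q.natDegree) =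
        fun _ => ‖x q.natDegree‖ ^ 2 := by
      funext j
      simp only [Function.comp, add_comm j, h4]
    rw [e]
    exact tendsto_const_nhds
  have h6 : ∀ k, q.natDegree ≤ k → x k = 0 := by
    intro k hk
    have := h4 (k - q.natDegree)
    rw [Nat.add_sub_cancel' hk] at this
    rw [← norm_eq_zero, this]
    exact pow_eq_zero_iff (two_ne_zero) |>.1 h5
  refine ⟨∑ k ∈ Finset.range q.natDegree, Polynomial.C (x k) * Polynomial.X ^ k, fun z hz => ?_⟩
  rw [hx z hz]
  refine (ev_hasSum (mem_disk.1 hz) x).unique ?_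
  have e : Polynomial.eval z (∑ k ∈ Finset.range q.natDegree,
      Polynomial.C (x k) * Polynomial.X ^ k) = ∑ k ∈ Finset.range q.natDegree, x k * z ^ k := by
    simp [Polynomial.eval_finsetSum]
  rw [e]
  refine hasSum_sum_of_ne_finset_zero fun k hk => ?_
  rw [h6 k (by simpa using hk), zero_mul]

/-- Polynomials by which one can divide with polynomial remainder in `H²`. -/
def DivA (A : Polynomial ℂ) : Prop :=
  ∀ F : ℂ → ℂ, InH2 F → ∃ G : ℂ → ℂ, InH2 G ∧ ∃ r : Polynomial ℂ,
    ∀ z ∈ unitDisk, F z = A.eval z * G z + r.eval z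

theorem DivA.one : DivA 1 := fun F hF => ⟨F, hF, 0, fun z _ => by simp⟩

theorem DivA.mul {A B : Polynomial ℂ} (hA : DivA A) (hB : DivA B) : DivA (A * B) := by
  intro F hF
  obtain ⟨G, hG, r, h⟩ := hA F hF
  obtain ⟨G', hG', r', h'⟩ := hB G hG
  refine ⟨G', hG', A * r' + r, fun z hz => ?_⟩
  rw [h z hz, h' z hz]
  simp
  ring

theorem DivA.pow {A : Polynomial ℂ} (hA : DivA A) (k : ℕ) : DivA (A ^ k) := by
  induction k with
  | zero => simpa using DivA.one
  | succ k ih => rw [pow_succ]; exact ih.mul hA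

theorem DivA.linear {ζ : ℂ} (hζ : ‖ζ‖ < 1) : DivA (Polynomial.X - Polynomial.C ζ) := by
  rintro F ⟨x, hx⟩
  have hn : ‖ζ • bshift‖ < 1 := by
    rw [norm_smul]
    nlinarith [bshift_norm, norm_nonneg ζ, norm_nonneg bshift]
  obtain ⟨U, hU⟩ := isUnit_one_sub_of_norm_lt_one hn
  let g : HH := (↑U⁻¹ : HH →L[ℂ] HH) (bshift x)
  have hg : g - ζ • bshift g = bshift x := by
    have h1 : (U : HH →L[ℂ] HH) g = bshift x := by
      change ((U : HH →L[ℂ] HH) * (↑U⁻¹ : HH →L[ℂ] HH)) (bshift x) = _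
      rw [Units.mul_inv]
      rfl
    rw [hU] at h1
    exact h1
  refine ⟨fun z => ev z g, ⟨g, fun _ _ => rfl⟩, Polynomial.C (x 0 + ζ * g 0), fun z hz => ?_⟩
  have hz' := mem_disk.1 hz
  have h2 := congrArg (fun y => z * ev z y) hg
  simp only [ev_sub, ev_smul] at h2
  have h3 := ev_bshift hz' x
  have h4 := ev_bshift hz' g
  rw [hx z hz]
  simp only [Polynomial.eval_sub, Polynomial.eval_X, Polynomial.eval_C]
  linear_combination -h2 - h3 - ζ * h4

/-- `a₁` as a polynomial. -/
def A1 {n : ℕ} (ξ : Fin n → ℂ) (m : Fin n → ℕ) : Polynomial ℂ :=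
  ∏ j, (Polynomial.X - Polynomial.C (ξ j)) ^ (m j)

theorem A1_eval {n : ℕ} (ξ : Fin n → ℂ) (m : Fin n → ℕ) (z : ℂ) :
    (A1 ξ m).eval z = a1fun ξ m z := by
  simp [A1, a1fun, Polynomial.eval_prod]

theorem A1_monic {n : ℕ} (ξ : Fin n → ℂ) (m : Fin n → ℕ) : (A1 ξ m).Monic :=
  Polynomial.monic_prod_of_monic _ _ fun _ _ => (Polynomial.monic_X_sub_C _).pow _

theorem A1_natDegree {n : ℕ} (ξ : Fin n → ℂ) (m : Fin n → ℕ) :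
    (A1 ξ m).natDegree = ∑ j, m j := by
  rw [A1, Polynomial.natDegree_prod_of_monic _ _
    fun j _ => (Polynomial.monic_X_sub_C _).pow _]
  simp

theorem A1_good {n : ℕ} {ξ : Fin n → ℂ} (m : Fin n → ℕ) (hξ : ∀ j, ‖ξ j‖ = 1) :
    GoodA (A1 ξ m) :=
  Finset.prod_induction _ GoodA (fun _ _ => GoodA.mul) GoodA.one
    fun j _ => (GoodA.linear (hξ j)).pow _

theorem a1fun_ne {n : ℕ} {ξ : Fin n → ℂ} (m : Fin n → ℕ) (hξ : ∀ j, ‖ξ j‖ = 1)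
    {z : ℂ} (hz : z ∈ unitDisk) : a1fun ξ m z ≠ 0 := by
  rw [a1fun, Finset.prod_ne_zero_iff]
  intro j _
  apply pow_ne_zero
  intro h
  have := mem_disk.1 hz
  rw [sub_eq_zero.1 h, hξ j] at this
  exact lt_irrefl _ this

theorem poly_eq_of_disk {p q : Polynomial ℂ} (h : ∀ z ∈ unitDisk, p.eval z = q.eval z) :
    p = q := by
  refine Polynomial.eq_of_infinite_eval_eq p q ?_
  refine Set.Infinite.mono (s := unitDisk) (fun z hz => h z hz) ?_
  exact infinite_of_mem_nhds (0 : ℂ) (Metric.ball_mem_nhds _ one_pos)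

/-- Uniqueness of the decomposition. -/
theorem decomp_zero {n : ℕ} {ξ : Fin n → ℂ} (m : Fin n → ℕ) (hξ : ∀ j, ‖ξ j‖ = 1)
    (x : HH) (q : Polynomial ℂ) (hq : q.degree < ((∑ j, m j : ℕ) : WithBot ℕ))
    (h : ∀ z ∈ unitDisk, a1fun ξ m z * ev z x + q.eval z = 0) : x = 0 ∧ q = 0 := by
  obtain ⟨p, hp⟩ := A1_good m hξ (fun z => ev z x) ⟨x, fun _ _ => rfl⟩ (-q) (fun z hz => by
    rw [A1_eval, Polynomial.eval_neg]
    linear_combination h z hz)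
  have h1 : A1 ξ m * p = -q := poly_eq_of_disk fun z hz => by
    rw [Polynomial.eval_mul, A1_eval, Polynomial.eval_neg, ← hp z hz]
    linear_combination h z hz
  have hp0 : p = 0 := by
    by_contra hne
    have h2 : (A1 ξ m * p).degree = (A1 ξ m).degree + p.degree := Polynomial.degree_mul
    rw [h1, Polynomial.degree_neg, Polynomial.degree_eq_natDegree (A1_monic ξ m).ne_zero,
      A1_natDegree, Polynomial.degree_eq_natDegree hne] at h2
    rw [h2] at hq
    have : ∑ j, m j + p.natDegree < ∑ j, m j := by exact_mod_cast hq
    omega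
  constructor
  · refine ev_inj fun z hz => ?_
    have e := hp z hz
    simp only [hp0, Polynomial.eval_zero] at e
    rw [e, ev, inner_zero_right]
  · rw [hp0, mul_zero] at h1
    exact neg_eq_zero.1 h1.symm

/-- The model space for `H(b)`. -/
abbrev EE (N : ℕ) := HH × EuclideanSpace ℂ (Fin N)

/-- The polynomial with given coefficients. -/
def cpoly {N : ℕ} (c : EuclideanSpace ℂ (Fin N)) : Polynomial ℂ :=
  ∑ i : Fin N, Polynomial.C (c i) * Polynomial.X ^ (i : ℕ)

theorem cpoly_eval {N : ℕ} (c : EuclideanSpace ℂ (Fin N)) (z : ℂ) :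
    (cpoly c).eval z = ∑ i : Fin N, c i * z ^ (i : ℕ) := by
  simp [cpoly, Polynomial.eval_finsetSum]

theorem cpoly_coeff {N : ℕ} (c : EuclideanSpace ℂ (Fin N)) (i : Fin N) :
    (cpoly c).coeff i = c i := by
  simp only [cpoly, Polynomial.finsetSum_coeff, Polynomial.coeff_C_mul, Polynomial.coeff_X_pow]
  rw [Finset.sum_eq_single i]
  · simp
  · intro j _ hj
    have : (i : ℕ) ≠ j := fun h => hj (Fin.ext h.symm)
    simp [this]
  · simp

theorem cpoly_degree {N : ℕ} (c : EuclideanSpace ℂ (Fin N)) :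
    (cpoly c).degree < (N : WithBot ℕ) :=
  Polynomial.degree_sum_fin_lt _

theorem cpoly_of_degree {N : ℕ} (q : Polynomial ℂ) (hq : q.degree < (N : WithBot ℕ)) :
    ∃ c : EuclideanSpace ℂ (Fin N), cpoly c = q ∧ h2NormSq (fun z => q.eval z) = ‖c‖ ^ 2 := by
  refine ⟨WithLp.toLp 2 (fun i : Fin N => q.coeff i), ?_, ?_⟩
  · ext k
    by_cases hk : k < N
    · have := cpoly_coeff (WithLp.toLp 2 (fun i : Fin N => q.coeff i)) ⟨k, hk⟩
      exact this
    · have hk' : (N : WithBot ℕ) ≤ k := by exact_mod_cast not_lt.1 hk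
      rw [Polynomial.coeff_eq_zero_of_degree_lt ((cpoly_degree _).trans_le hk'),
        Polynomial.coeff_eq_zero_of_degree_lt (hq.trans_le hk')]
  · rw [EuclideanSpace.norm_sq_eq]
    have h1 : ∀ k, taylorCoeff (fun z => q.eval z) k = q.coeff k := fun k =>
      taylorCoeff_of_eq (x := polyH q) (fun z hz => (ev_polyH (mem_disk.1 hz) q).symm) k
    simp only [h2NormSq, h1]
    rw [tsum_eq_sum (s := Finset.range N)]
    · exact (Fin.sum_univ_eq_sum_range (fun k => ‖q.coeff k‖ ^ 2) N).symm
    · intro k hk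
      have hk' : (N : WithBot ℕ) ≤ k := by
        exact_mod_cast not_lt.1 (fun h => hk (Finset.mem_range.2 h))
      rw [Polynomial.coeff_eq_zero_of_degree_lt (hq.trans_le hk')]
      simp

/-- Evaluation on the model space. -/
def evE {n : ℕ} (ξ : Fin n → ℂ) (m : Fin n → ℕ) (z : ℂ) : EE (∑ j, m j) →L[ℂ] ℂ :=
  a1fun ξ m z • (innerSL ℂ (kv z)).comp (ContinuousLinearMap.fst ℂ _ _) +
    ∑ i : Fin (∑ j, m j), z ^ (i : ℕ) •
      (EuclideanSpace.proj i : EuclideanSpace ℂ (Fin (∑ j, m j)) →L[ℂ] ℂ).comp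
        (ContinuousLinearMap.snd ℂ HH _)

theorem evE_apply {n : ℕ} (ξ : Fin n → ℂ) (m : Fin n → ℕ) (z : ℂ) (e : EE (∑ j, m j)) :
    evE ξ m z e = a1fun ξ m z * ev z e.1 + (cpoly e.2).eval z := by
  rw [cpoly_eval]
  simp [evE, ev, mul_comm]

theorem evE_inj {n : ℕ} {ξ : Fin n → ℂ} (m : Fin n → ℕ) (hξ : ∀ j, ‖ξ j‖ = 1)
    {e e' : EE (∑ j, m j)} (h : ∀ z ∈ unitDisk, evE ξ m z e = evE ξ m z e') : e = e' := by
  rw [← sub_eq_zero]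
  have h1 : ∀ z ∈ unitDisk, evE ξ m z (e - e') = 0 := fun z hz => by
    rw [map_sub, h z hz, sub_self]
  simp only [evE_apply] at h1
  obtain ⟨h2, h3⟩ := decomp_zero m hξ _ _ (cpoly_degree _) h1
  refine Prod.ext h2 ?_
  ext i
  rw [← cpoly_coeff, h3]
  simp

theorem exists_EE_of_decomp {n : ℕ} {ξ : Fin n → ℂ} {m : Fin n → ℕ} {f g : ℂ → ℂ}
    {q : Polynomial ℂ} (h : HbDecompOf ξ m f g q) :
    ∃ e : EE (∑ j, m j), (∀ z ∈ unitDisk, f z = evE ξ m z e) ∧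
      h2NormSq g + h2NormSq (fun z => q.eval z) = ‖e.1‖ ^ 2 + ‖e.2‖ ^ 2 := by
  obtain ⟨hg, hq, hf⟩ := h
  obtain ⟨x, hx⟩ := exists_of_memH2 hg
  obtain ⟨c, hc, hc'⟩ := cpoly_of_degree q hq
  refine ⟨(x, c), fun z hz => ?_, ?_⟩
  · rw [evE_apply, hf z hz, hx z hz, hc]
  · rw [h2NormSq_of_eq hx, hc']

theorem exists_EE_of_mem {n : ℕ} {ξ : Fin n → ℂ} {m : Fin n → ℕ} {f : ℂ → ℂ}
    (h : MemHb ξ m f) :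
    ∃ e : EE (∑ j, m j), (∀ z ∈ unitDisk, f z = evE ξ m z e) ∧
      hbNormSq ξ m f = ‖e.1‖ ^ 2 + ‖e.2‖ ^ 2 := by
  have h1 : HbDecompOf ξ m f (hbDecomp ξ m f).1 (hbDecomp ξ m f).2 := by
    rw [hbDecomp, dif_pos h]
    exact h.choose_spec
  exact exists_EE_of_decomp h1

theorem mem_of_EE {n : ℕ} {ξ : Fin n → ℂ} {m : Fin n → ℕ} {f : ℂ → ℂ} (e : EE (∑ j, m j))
    (h : ∀ z ∈ unitDisk, f z = evE ξ m z e) : MemHb ξ m f := by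
  refine ⟨(fun z => ev z e.1, cpoly e.2), memH2_of_eq (x := e.1) (fun _ _ => rfl),
    cpoly_degree _, fun z hz => ?_⟩
  rw [h z hz, evE_apply]

/-- `f ∈ a₁ H² + ` polynomials. -/
def InHb {n : ℕ} (ξ : Fin n → ℂ) (m : Fin n → ℕ) (f : ℂ → ℂ) : Prop :=
  ∃ g : ℂ → ℂ, InH2 g ∧ ∃ q : Polynomial ℂ, ∀ z ∈ unitDisk, f z = a1fun ξ m z * g z + q.eval z

theorem InHb.toEE {n : ℕ} {ξ : Fin n → ℂ} {m : Fin n → ℕ} {f : ℂ → ℂ} (h : InHb ξ m f) :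
    ∃ e : EE (∑ j, m j), ∀ z ∈ unitDisk, f z = evE ξ m z e := by
  obtain ⟨g, hg, q, hf⟩ := h
  obtain ⟨x, hx⟩ := hg.add (InH2.poly (q /ₘ A1 ξ m))
  have hd := Polynomial.degree_modByMonic_lt q (A1_monic ξ m)
  rw [Polynomial.degree_eq_natDegree (A1_monic ξ m).ne_zero, A1_natDegree] at hd
  obtain ⟨c, hc, -⟩ := cpoly_of_degree _ hd
  refine ⟨(x, c), fun z hz => ?_⟩
  rw [evE_apply, hc, hf z hz, ← hx z hz]
  have h1 := congrArg (Polynomial.eval z) (Polynomial.modByMonic_add_div q (A1 ξ m))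
  rw [Polynomial.eval_add, Polynomial.eval_mul, A1_eval] at h1
  linear_combination -h1

theorem InHb.add {n : ℕ} {ξ : Fin n → ℂ} {m : Fin n → ℕ} {f f' : ℂ → ℂ} (h : InHb ξ m f)
    (h' : InHb ξ m f') : InHb ξ m (fun z => f z + f' z) := by
  obtain ⟨g, hg, q, hf⟩ := h
  obtain ⟨g', hg', q', hf'⟩ := h'
  refine ⟨_, hg.add hg', q + q', fun z hz => ?_⟩
  simp only [hf z hz, hf' z hz, Polynomial.eval_add]
  ring

theorem InHb.mul_poly {n : ℕ} {ξ : Fin n → ℂ} {m : Fin n → ℕ} {f : ℂ → ℂ} (h : InHb ξ m f)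
    (p : Polynomial ℂ) : InHb ξ m (fun z => p.eval z * f z) := by
  obtain ⟨g, hg, q, hf⟩ := h
  refine ⟨_, hg.mul_poly p, p * q, fun z hz => ?_⟩
  simp only [hf z hz, Polynomial.eval_mul]
  ring

theorem InHb.mul_phi {n : ℕ} {ξ : Fin n → ℂ} {m : Fin n → ℕ} {f φ : ℂ → ℂ} (h : InHb ξ m f)
    (hφ : InHb ξ m φ) (hm : ∀ G, InH2 G → InH2 (fun z => φ z * G z)) :
    InHb ξ m (fun z => φ z * f z) := by
  obtain ⟨g, hg, q, hf⟩ := h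
  obtain ⟨g', hg', q', hf'⟩ := hφ.mul_poly q
  refine ⟨_, (hm g hg).add hg', q', fun z hz => ?_⟩
  have := hf' z hz
  simp only [hf z hz]
  linear_combination this

theorem InHb.poly {n : ℕ} (ξ : Fin n → ℂ) (m : Fin n → ℕ) (q : Polynomial ℂ) :
    InHb ξ m (fun z => q.eval z) :=
  ⟨fun _ => 0, by simpa using InH2.poly 0, q, fun z _ => by simp⟩

open Polynomial in
theorem InHb.poly_comp {n : ℕ} {ξ : Fin n → ℂ} {m : Fin n → ℕ} {φ : ℂ → ℂ}
    (hφ : InHb ξ m φ) (hm : ∀ G, InH2 G → InH2 (fun z => φ z * G z)) (s : ℂ[X]) :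
    InHb ξ m (fun z => s.eval (φ z)) := by
  induction s using Polynomial.induction_on with
  | C a => simpa using InHb.poly ξ m (C a)
  | add p q hp hq => simpa using hp.add hq
  | monomial k a h =>
    have h1 := h.mul_phi hφ hm
    have e : (fun z => (C a * X ^ (k + 1) : ℂ[X]).eval (φ z)) =
        fun z => φ z * (C a * X ^ k : ℂ[X]).eval (φ z) := by
      funext z
      simp [pow_succ]; ring
    rw [e]
    exact h1

/-- Boundedness from stability, by the closed graph theorem. -/
theorem compBdd_of_stable {n : ℕ} {ξ : Fin n → ℂ} (m : Fin n → ℕ) (hξ : ∀ j, ‖ξ j‖ = 1)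
    {φ : ℂ → ℂ} (hφ : ∀ z ∈ unitDisk, φ z ∈ unitDisk)
    (h : ∀ e : EE (∑ j, m j), ∃ e' : EE (∑ j, m j),
      ∀ z ∈ unitDisk, evE ξ m (φ z) e = evE ξ m z e') : CompBddHb ξ m φ := by
  choose T hT using h
  let TL : EE (∑ j, m j) →ₗ[ℂ] EE (∑ j, m j) :=
    { toFun := T
      map_add' := fun x y => evE_inj m hξ fun z hz => by
        rw [← hT _ z hz, map_add, map_add, hT _ z hz, hT _ z hz]
      map_smul' := fun c x => evE_inj m hξ fun z hz => by
        rw [← hT _ z hz, map_smul, RingHom.id_apply, map_smul, hT _ z hz] }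
  have hcont : Continuous TL := by
    refine TL.continuous_of_seq_closed_graph fun v x y hv hTv => ?_
    refine evE_inj m hξ fun z hz => ?_
    have h1 : Tendsto (fun k => evE ξ m z (T (v k))) atTop (nhds (evE ξ m z y)) :=
      ((evE ξ m z).continuous.tendsto y).comp hTv
    have h2 : Tendsto (fun k => evE ξ m (φ z) (v k)) atTop (nhds (evE ξ m (φ z) x)) :=
      ((evE ξ m (φ z)).continuous.tendsto x).comp hv
    simp only [← hT _ z hz] at h1
    rw [tendsto_nhds_unique h1 h2]
    exact hT x z hz
  let TC : EE (∑ j, m j) →L[ℂ] EE (∑ j, m j) := ⟨TL, hcont⟩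
  have key : ∀ (f : ℂ → ℂ) (e : EE (∑ j, m j)), (∀ z ∈ unitDisk, f z = evE ξ m z e) →
      ∀ z ∈ unitDisk, f (φ z) = evE ξ m z (T e) := by
    intro f e he z hz
    rw [he _ (hφ z hz), hT e z hz]
  refine ⟨fun f hf => ?_, 2 * ‖TC‖ ^ 2, fun f hf => ?_⟩
  · obtain ⟨e, he, -⟩ := exists_EE_of_mem hf
    exact mem_of_EE (T e) (key f e he)
  · obtain ⟨e, he, hn⟩ := exists_EE_of_mem hf
    have hmem : MemHb ξ m fun z => f (φ z) := mem_of_EE (T e) (key f e he)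
    obtain ⟨e', he', hn'⟩ := exists_EE_of_mem hmem
    have hee : e' = T e := evE_inj m hξ fun z hz => by rw [← he' z hz, key f e he z hz]
    rw [hn, hn', hee]
    have h1 : ‖T e‖ ≤ ‖TC‖ * ‖e‖ := TC.le_opNorm e
    have h2 : ‖(T e).1‖ ≤ ‖T e‖ := norm_fst_le _
    have h3 : ‖(T e).2‖ ≤ ‖T e‖ := norm_snd_le _
    have h4 : ‖e‖ ^ 2 ≤ ‖e.1‖ ^ 2 + ‖e.2‖ ^ 2 := by
      rw [Prod.norm_def]
      rcases max_cases ‖e.1‖ ‖e.2‖ with ⟨h, -⟩ | ⟨h, -⟩ <;> rw [h] <;>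
        nlinarith [sq_nonneg ‖e.1‖, sq_nonneg ‖e.2‖]
    calc ‖(T e).1‖ ^ 2 + ‖(T e).2‖ ^ 2 ≤ ‖T e‖ ^ 2 + ‖T e‖ ^ 2 := by gcongr
      _ = 2 * ‖T e‖ ^ 2 := by ring
      _ ≤ 2 * (‖TC‖ * ‖e‖) ^ 2 := by gcongr
      _ = 2 * ‖TC‖ ^ 2 * ‖e‖ ^ 2 := by ring
      _ ≤ 2 * ‖TC‖ ^ 2 * (‖e.1‖ ^ 2 + ‖e.2‖ ^ 2) := by gcongr

/-- If `u` vanishes identically then `φ` is constant. -/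
theorem const_of_u_zero {n : ℕ} {ξ : Fin n → ℂ} (m : Fin n → ℕ) (hξ : ∀ j, ‖ξ j‖ = 1)
    {φ : ℂ → ℂ} (hd : DifferentiableOn ℂ φ unitDisk) (hφ : ∀ z ∈ unitDisk, φ z ∈ unitDisk)
    (Λ : Fin n → ℂ) (p : ℕ) (h : ∀ z ∈ unitDisk, ufun p ξ m Λ φ z = 0) :
    ∀ z ∈ unitDisk, φ z = φ 0 := by
  have h0 : (0 : ℂ) ∈ unitDisk := mem_disk.2 (by simp)
  have hsub : φ '' unitDisk ⊆ Set.range Λ := by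
    rintro _ ⟨z, hz, rfl⟩
    have h1 := h z hz
    rw [ufun, div_eq_zero_iff, or_iff_left (a1fun_ne m hξ hz), mul_eq_zero,
      or_iff_right (a1fun_ne m hξ (hφ z hz)), Finset.prod_eq_zero_iff] at h1
    obtain ⟨j, -, hj⟩ := h1
    exact ⟨j, (sub_eq_zero.1 (by_contra fun hc => pow_ne_zero _ hc hj)).symm⟩
  have hpre : IsPreconnected (φ '' unitDisk) :=
    ((convex_ball (0 : ℂ) 1).isPreconnected).image φ hd.continuousOn
  intro z hz
  by_contra hne
  exact hpre.infinite_of_nontrivial ⟨_, ⟨z, hz, rfl⟩, _, ⟨0, h0, rfl⟩, hne⟩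
    ((Set.finite_range Λ).subset hsub)

/-- Corollary 4.8. If `u ∈ H(φ)` (de Branges–Rovnyak space of the
symbol `φ`), then `C_φ` is bounded on `H(b)`. -/
theorem comp_bounded_of_u_in_Hphi
    (b a : ℂ → ℂ) (n : ℕ) (ξ : Fin n → ℂ) (m : Fin n → ℕ)
    (hset : RationalSetting b a n ξ m)
    (φ : ℂ → ℂ) (hφb : MemHb ξ m φ) (hφball : MemBallHinf φ)
    (hφmap : ∀ z ∈ unitDisk, φ z ∈ unitDisk)
    (Λ : Fin n → ℂ) (hΛ : ∀ j, NTLimit φ (ξ j) (Λ j))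
    (p : ℕ) (hp : p ≤ n)
    (hΛcirc : ∀ j : Fin n, (j : ℕ) < p → ∃ i, Λ j = ξ i)
    (hΛdisk : ∀ j : Fin n, p ≤ (j : ℕ) → Λ j ∈ unitDisk)
    (hu : MemHbRK φ (ufun p ξ m Λ φ)) :
    CompBddHb ξ m φ := by
  have hξ : ∀ j, ‖ξ j‖ = 1 := fun j => by simpa [unitCircle] using hset.zeros_mem j
  have h0 : (0 : ℂ) ∈ unitDisk := mem_disk.2 (by simp)
  obtain ⟨t, ht⟩ := hu
  refine compBdd_of_stable m hξ hφmap fun e => ?_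
  suffices hs : InHb ξ m (fun z => evE ξ m (φ z) e) from hs.toEE
  rcases le_or_gt t 0 with hneg | hpos
  · -- here `u = 0`, so `φ` is constant
    have hu0 : ∀ z ∈ unitDisk, ufun p ξ m Λ φ z = 0 := by
      intro z hz
      have h1 := ht 1 (fun _ => z) (fun _ => 1) (fun _ => hz)
      rw [rk_sum φ 1 _ _ (fun _ => hz)] at h1
      simp only [Finset.univ_unique, Finset.sum_const, Finset.card_singleton, one_smul, map_one,
        one_mul, norm_smul, RCLike.norm_conj] at h1
      have h2 := mem_disk.1 (hφmap z hz)
      have h3 : 0 ≤ ‖kv z‖ ^ 2 - (‖φ z‖ * ‖kv z‖) ^ 2 := by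
        rw [mul_pow]
        have : ‖φ z‖ ^ 2 ≤ 1 := by nlinarith [norm_nonneg (φ z)]
        nlinarith [sq_nonneg ‖kv z‖]
      have h4 : ‖ufun p ξ m Λ φ z‖ ^ 2 ≤ 0 := h1.trans (mul_nonpos_of_nonpos_of_nonneg hneg h3)
      have h5 : ‖ufun p ξ m Λ φ z‖ = 0 := by nlinarith [norm_nonneg (ufun p ξ m Λ φ z)]
      exact norm_eq_zero.1 h5
    have hc := const_of_u_zero m hξ hφball.1 hφmap Λ p hu0
    obtain ⟨g, hg, q, hq⟩ := InHb.poly ξ m (Polynomial.C (evE ξ m (φ 0) e))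
    refine ⟨g, hg, q, fun z hz => ?_⟩
    rw [← hq z hz]
    simp only [Polynomial.eval_C, hc z hz]
  · have hm : ∀ G, InH2 G → InH2 (fun z => φ z * G z) := fun G hG => mult_inH2 hpos ht hG
    have hφI : InHb ξ m φ := by
      obtain ⟨⟨g, q⟩, hg, -, hf⟩ := hφb
      exact ⟨g, exists_of_memH2 hg, q, hf⟩
    let P : Polynomial ℂ := ∏ j ∈ Finset.univ.filter fun j : Fin n => p ≤ (j : ℕ),
      (Polynomial.X - Polynomial.C (Λ j)) ^ (m j)
    have hP : DivA P := Finset.prod_induction _ DivA (fun _ _ => DivA.mul) DivA.one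
      fun j hj => (DivA.linear (mem_disk.1 (hΛdisk j (Finset.mem_filter.1 hj).2))).pow _
    have hPe : ∀ w, P.eval w = ∏ j ∈ Finset.univ.filter fun j : Fin n => p ≤ (j : ℕ),
        (w - Λ j) ^ (m j) := fun w => by simp [P, Polynomial.eval_prod]
    obtain ⟨G, hG, r, hr⟩ := hP (fun z => ev z e.1) ⟨e.1, fun _ _ => rfl⟩
    have hw := wcomp_inH2 hpos.le ht hφmap hG
    have h1 : InHb ξ m (fun z => a1fun ξ m z * (ufun p ξ m Λ φ z * G (φ z))) :=
      ⟨_, hw, 0, fun z _ => by simp⟩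
    obtain ⟨g, hg, q, hq⟩ := h1.add (InHb.poly_comp hφI hm (A1 ξ m * r + cpoly e.2))
    refine ⟨g, hg, q, fun z hz => ?_⟩
    rw [← hq z hz]
    change evE ξ m (φ z) e = a1fun ξ m z * (ufun p ξ m Λ φ z * G (φ z)) +
      Polynomial.eval (φ z) (A1 ξ m * r + cpoly e.2)
    rw [evE_apply, hr _ (hφmap z hz), Polynomial.eval_add, Polynomial.eval_mul, A1_eval,
      hPe, ufun]
    have hne := a1fun_ne m hξ hz
    field_simp
    ring

end
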